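/- Let α ∈ ℝ^d, let v : ℝ^d → ℝ be ℤ^d-periodic and continuous, E ∈ ℝ, and suppose there exists a map B : ℝ^d → SL(2, ℝ) with sup_x ‖B(x)‖ < ∞ such that B(x+α)^{−1} S_E^v(x) B(x) equals a constant matrix R for all x. (1) If R = [[cos 2πρ, −sin 2πρ], [sin 2πρ, cos 2πρ]] for some ρ ∈ ℝ, then there exists C > 0 such that for every θ ∈ ℝ^d and all sufficiently large integers k: C^{−1}k ≤ ‖P_{(k),±}(θ)^{−1}‖^{−1} ≤ Ck, C^{−1}k² ≤ det P_{(k),±}(θ) ≤ Ck², and there exists β ∈ (−π/2, π/2] with C^{−1}k ≤ ‖u_β^±‖²_{2k} ≤ Ck. (2) If R = [[1, ν], [0, 1]] for some ν ≠ 0, then there exists C > 0 such that for every θ ∈ ℝ^d and all sufficiently large integers k: C^{−1}k ≤ ‖P_{(k),±}(θ)^{−1}‖^{−1} ≤ Ck, C^{−1}k⁴ ≤ det P_{(k),±}(θ) ≤ Ck⁴, and there exists β ∈ (−π/2, π/2] with C^{−1}k ≤ ‖u_β^±‖²_{2k} ≤ Ck. -/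

import Mathlib

noncomputable section

/-- Spectral (operator) norm of a 2×2 matrix over an `RCLike` field. -/
def spNorm {𝕜 : Type*} [RCLike 𝕜] (M : Matrix (Fin 2) (Fin 2) 𝕜) : ℝ :=
  ‖(Matrix.toEuclideanCLM (𝕜 := 𝕜) M : EuclideanSpace 𝕜 (Fin 2) →L[𝕜] EuclideanSpace 𝕜 (Fin 2))‖

/-- Schrödinger cocycle matrix `S_E^v(x)`. -/
def schMat {d : ℕ} (v : (Fin d → ℝ) → ℝ) (E : ℝ) (x : Fin d → ℝ) : Matrix (Fin 2) (Fin 2) ℝ :=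
  !![E - v x, -1; 1, 0]

/-- Iterates `A(x+(m−1)α)⋯A(x+α)A(x)` of a quasiperiodic cocycle. -/
def cocIter {d : ℕ} {R : Type*} [Ring R] (α : Fin d → ℝ)
    (A : (Fin d → ℝ) → Matrix (Fin 2) (Fin 2) R) : ℕ → (Fin d → ℝ) → Matrix (Fin 2) (Fin 2) R
  | 0, _ => 1
  | (m + 1), x => A (x + (m : ℝ) • α) * cocIter α A m x

/-- `P_{(k),+}(θ)`. -/
def Pplus {d : ℕ} (v : (Fin d → ℝ) → ℝ) (α : Fin d → ℝ) (E : ℝ) (k : ℕ) (θ : Fin d → ℝ) :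
    Matrix (Fin 2) (Fin 2) ℝ :=
  ∑ i ∈ Finset.range k,
    (cocIter α (schMat v E) (2 * i + 1) (θ + α)).transpose *
      cocIter α (schMat v E) (2 * i + 1) (θ + α)

/-- `P_{(k),−}(θ)`, built from `𝒜_{−m}(x) = 𝒜_m(x − mα)⁻¹`. -/
def Pminus {d : ℕ} (v : (Fin d → ℝ) → ℝ) (α : Fin d → ℝ) (E : ℝ) (k : ℕ) (θ : Fin d → ℝ) :
    Matrix (Fin 2) (Fin 2) ℝ :=
  ∑ i ∈ Finset.range k,
    ((cocIter α (schMat v E) (2 * i + 1) (θ + α - (2 * i + 1 : ℝ) • α))⁻¹).transpose *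
      (cocIter α (schMat v E) (2 * i + 1) (θ + α - (2 * i + 1 : ℝ) • α))⁻¹

/-- `u` solves the eigenvalue equation `u(n+1) + u(n−1) + v(θ+nα)u(n) = E·u(n)`. -/
def IsSolution {d : ℕ} (v : (Fin d → ℝ) → ℝ) (α θ : Fin d → ℝ) (E : ℝ) (u : ℤ → ℝ) : Prop :=
  ∀ n : ℤ, u (n + 1) + u (n - 1) + v (θ + (n : ℝ) • α) * u n = E * u n

def normSqPlus (u : ℤ → ℝ) (k : ℕ) : ℝ := ∑ i ∈ Finset.range (2 * k), u ((i : ℤ) + 1) ^ 2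
def normSqMinus (u : ℤ → ℝ) (k : ℕ) : ℝ := ∑ i ∈ Finset.range (2 * k), u (-(i : ℤ)) ^ 2

/-- The asymptotic conclusion of STATEMENT 12, with `det P_{(k),±} ≍ k^p`. -/
def ReducibleAsymptotics {d : ℕ} (v : (Fin d → ℝ) → ℝ) (α : Fin d → ℝ) (E : ℝ) (p : ℕ) : Prop :=
  ∃ C > (0 : ℝ), ∀ θ : Fin d → ℝ, ∃ k₀ : ℕ, ∀ k : ℕ, k₀ ≤ k →
    (C⁻¹ * k ≤ (spNorm ((Pplus v α E k θ)⁻¹))⁻¹ ∧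
      (spNorm ((Pplus v α E k θ)⁻¹))⁻¹ ≤ C * k) ∧
    (C⁻¹ * k ≤ (spNorm ((Pminus v α E k θ)⁻¹))⁻¹ ∧
      (spNorm ((Pminus v α E k θ)⁻¹))⁻¹ ≤ C * k) ∧
    (C⁻¹ * (k : ℝ) ^ p ≤ (Pplus v α E k θ).det ∧ (Pplus v α E k θ).det ≤ C * (k : ℝ) ^ p) ∧
    (C⁻¹ * (k : ℝ) ^ p ≤ (Pminus v α E k θ).det ∧ (Pminus v α E k θ).det ≤ C * (k : ℝ) ^ p) ∧
    ∃ β ∈ Set.Ioc (-(Real.pi / 2)) (Real.pi / 2), ∀ u : ℤ → ℝ,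
      IsSolution v α θ E u → u 0 * Real.cos β + u 1 * Real.sin β = 0 →
      u 0 ^ 2 + u 1 ^ 2 = 1 →
        (C⁻¹ * k ≤ normSqPlus u k ∧ normSqPlus u k ≤ C * k) ∧
        (C⁻¹ * k ≤ normSqMinus u k ∧ normSqMinus u k ≤ C * k)

open Matrix

/-- Squared Euclidean norm of a real vector with two coordinates. -/
def vecSq (w : Fin 2 → ℝ) : ℝ := w 0 ^ 2 + w 1 ^ 2

/-- Squared Frobenius norm of a real 2×2 matrix. -/
def frobSq (M : Matrix (Fin 2) (Fin 2) ℝ) : ℝ :=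
  M 0 0 ^ 2 + M 0 1 ^ 2 + M 1 0 ^ 2 + M 1 1 ^ 2

/-- Sum of the Gram matrices of the first `k` terms of a sequence of matrices. -/
def gramSum (A : ℕ → Matrix (Fin 2) (Fin 2) ℝ) (k : ℕ) : Matrix (Fin 2) (Fin 2) ℝ :=
  ∑ i ∈ Finset.range k, (A i)ᵀ * A i

theorem vecSq_nonneg (w : Fin 2 → ℝ) : 0 ≤ vecSq w := by unfold vecSq; positivity

theorem frobSq_nonneg (M : Matrix (Fin 2) (Fin 2) ℝ) : 0 ≤ frobSq M := by
  unfold frobSq; positivity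

theorem vecSq_mulVec_le (M : Matrix (Fin 2) (Fin 2) ℝ) (w : Fin 2 → ℝ) :
    vecSq (M *ᵥ w) ≤ frobSq M * vecSq w := by
  simp only [vecSq, frobSq, mulVec_fin_two, cons_val_zero, cons_val_one]
  nlinarith [sq_nonneg (M 0 0 * w 1 - M 0 1 * w 0), sq_nonneg (M 1 0 * w 1 - M 1 1 * w 0)]

theorem frobSq_mul_le (M N : Matrix (Fin 2) (Fin 2) ℝ) :
    frobSq (M * N) ≤ frobSq M * frobSq N := by
  have h0 := vecSq_mulVec_le M ![N 0 0, N 1 0]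
  have h1 := vecSq_mulVec_le M ![N 0 1, N 1 1]
  simp only [vecSq, mulVec_fin_two, cons_val_zero, cons_val_one] at h0 h1
  have hN : frobSq N = (N 0 0 ^ 2 + N 1 0 ^ 2) + (N 0 1 ^ 2 + N 1 1 ^ 2) := by
    unfold frobSq; ring
  rw [hN, mul_add]
  refine le_trans (le_of_eq ?_) (add_le_add h0 h1)
  simp only [frobSq, mul_apply, Fin.sum_univ_two]
  ring

theorem inv_of_det_eq_one {M : Matrix (Fin 2) (Fin 2) ℝ} (h : M.det = 1) :
    M⁻¹ = !![M 1 1, -M 0 1; -M 1 0, M 0 0] := by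
  rw [inv_def, h, Ring.inverse_one, one_smul, adjugate_fin_two]

theorem frobSq_inv {M : Matrix (Fin 2) (Fin 2) ℝ} (h : M.det = 1) :
    frobSq M⁻¹ = frobSq M := by
  rw [inv_of_det_eq_one h]
  simp [frobSq]
  ring

theorem vecSq_le_mulVec {M : Matrix (Fin 2) (Fin 2) ℝ} (h : M.det = 1) (w : Fin 2 → ℝ) :
    vecSq w ≤ frobSq M * vecSq (M *ᵥ w) := by
  have := vecSq_mulVec_le M⁻¹ (M *ᵥ w)
  rwa [mulVec_mulVec, nonsing_inv_mul _ (by simp [h]), one_mulVec, frobSq_inv h] at this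

theorem norm_toLp_two (w : Fin 2 → ℝ) :
    ‖(WithLp.toLp 2 w : EuclideanSpace ℝ (Fin 2))‖ = √(vecSq w) := by
  simp [EuclideanSpace.norm_eq, vecSq, Fin.sum_univ_two]

theorem spNorm_le {M : Matrix (Fin 2) (Fin 2) ℝ} {c : ℝ} (hc : 0 ≤ c) (h : frobSq M ≤ c ^ 2) :
    spNorm M ≤ c := by
  refine ContinuousLinearMap.opNorm_le_bound _ hc fun x => ?_
  obtain ⟨w, rfl⟩ : ∃ w, x = WithLp.toLp 2 w := ⟨x.ofLp, rfl⟩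
  rw [toEuclideanCLM_toLp, norm_toLp_two, norm_toLp_two, ← Real.sqrt_sq hc,
    ← Real.sqrt_mul (sq_nonneg c)]
  exact Real.sqrt_le_sqrt ((vecSq_mulVec_le M w).trans
    (mul_le_mul_of_nonneg_right h (vecSq_nonneg w)))

theorem vecSq_mulVec_le_spNorm (M : Matrix (Fin 2) (Fin 2) ℝ) (w : Fin 2 → ℝ) (hw : vecSq w = 1) :
    vecSq (M *ᵥ w) ≤ spNorm M ^ 2 := by
  have h := (toEuclideanCLM (𝕜 := ℝ) M).le_opNorm (WithLp.toLp 2 w)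
  rw [toEuclideanCLM_toLp, norm_toLp_two, norm_toLp_two, hw, Real.sqrt_one, mul_one] at h
  exact Real.sqrt_le_left (norm_nonneg _) |>.mp h

theorem frobSq_le_spNorm (M : Matrix (Fin 2) (Fin 2) ℝ) : frobSq M ≤ 2 * spNorm M ^ 2 := by
  have h0 := vecSq_mulVec_le_spNorm M ![1, 0] (by simp [vecSq])
  have h1 := vecSq_mulVec_le_spNorm M ![0, 1] (by simp [vecSq])
  simp only [vecSq, mulVec_fin_two, cons_val_zero, cons_val_one] at h0 h1
  unfold frobSq
  nlinarith

theorem spNorm_nonneg (M : Matrix (Fin 2) (Fin 2) ℝ) : 0 ≤ spNorm M := norm_nonneg _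

theorem inv_spNorm_inv_bounds {P : Matrix (Fin 2) (Fin 2) ℝ} (hP : P.PosSemidef)
    (hdet : 0 < P.det) :
    P.det / P.trace ≤ (spNorm P⁻¹)⁻¹ ∧ (spNorm P⁻¹)⁻¹ ≤ 2 * (P.det / P.trace) := by
  have h00 : 0 ≤ P 0 0 := hP.diag_nonneg
  have h11 : 0 ≤ P 1 1 := hP.diag_nonneg
  have hsymm : P 1 0 = P 0 1 := by simpa using hP.isHermitian.apply 0 1
  have hinv : P⁻¹ = !![P 1 1 / P.det, -P 0 1 / P.det; -P 0 1 / P.det, P 0 0 / P.det] := by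
    rw [inv_def, Ring.inverse_eq_inv', adjugate_fin_two, hsymm]
    ext i j
    fin_cases i <;> fin_cases j <;> simp <;> ring
  have hd : P.det = P 0 0 * P 1 1 - P 0 1 ^ 2 := by rw [det_fin_two, hsymm]; ring
  have htr : P.trace = P 0 0 + P 1 1 := trace_fin_two P
  have htr0 : 0 < P.trace := by
    rw [htr]
    rcases h00.eq_or_lt with h | h
    · rw [← h] at hd; nlinarith [sq_nonneg (P 0 1)]
    · linarith
  have hup : spNorm P⁻¹ ≤ P.trace / P.det := by
    refine spNorm_le (by positivity) ?_
    rw [hinv, frobSq, htr]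
    simp only [of_apply, cons_val', cons_val_zero, cons_val_one, cons_val_fin_one, div_pow]
    rw [← add_div, ← add_div, ← add_div]
    gcongr
    nlinarith
  have hlow : P.trace / P.det / 2 ≤ spNorm P⁻¹ := by
    have h0 := vecSq_mulVec_le_spNorm P⁻¹ ![1, 0] (by simp [vecSq])
    have h1 := vecSq_mulVec_le_spNorm P⁻¹ ![0, 1] (by simp [vecSq])
    rw [hinv] at h0 h1
    simp only [vecSq, mulVec_fin_two, of_apply, cons_val', cons_val_zero, cons_val_one,
      cons_val_fin_one, mul_one, mul_zero, add_zero, zero_add] at h0 h1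
    rw [← hinv] at h0 h1
    have h0' : P 1 1 / P.det ≤ spNorm P⁻¹ :=
      abs_le_of_sq_le_sq' (by nlinarith [sq_nonneg (-P 0 1 / P.det)]) (spNorm_nonneg _) |>.2
    have h1' : P 0 0 / P.det ≤ spNorm P⁻¹ :=
      abs_le_of_sq_le_sq' (by nlinarith [sq_nonneg (-P 0 1 / P.det)]) (spNorm_nonneg _) |>.2
    rw [htr, add_div]
    linarith
  have hpos : 0 < P.trace / P.det := by positivity
  constructor
  · rw [← inv_div]
    exact inv_anti₀ (by linarith) hup
  · have := inv_anti₀ (by linarith) hlow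
    rwa [inv_div, div_eq_mul_inv, inv_div] at this

theorem det_le_det_of_posSemidef_sub {P Q : Matrix (Fin 2) (Fin 2) ℝ} (hQ : Q.PosSemidef)
    (hPQ : (P - Q).PosSemidef) : Q.det ≤ P.det := by
  obtain ⟨D, rfl⟩ : ∃ D, P = Q + D := ⟨P - Q, by abel⟩
  rw [add_sub_cancel_left] at hPQ
  have q0 : 0 ≤ Q 0 0 := hQ.diag_nonneg
  have q1 : 0 ≤ Q 1 1 := hQ.diag_nonneg
  have d0 : 0 ≤ D 0 0 := hPQ.diag_nonneg
  have d1 : 0 ≤ D 1 1 := hPQ.diag_nonneg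
  have qs : Q 1 0 = Q 0 1 := by simpa using hQ.isHermitian.apply 0 1
  have ds : D 1 0 = D 0 1 := by simpa using hPQ.isHermitian.apply 0 1
  have qd := hQ.det_nonneg
  have dd := hPQ.det_nonneg
  rw [det_fin_two, qs] at qd
  rw [det_fin_two, ds] at dd
  have key : |2 * Q 0 1 * D 0 1| ≤ Q 0 0 * D 1 1 + Q 1 1 * D 0 0 := by
    refine abs_le_of_sq_le_sq ?_ (by positivity)
    have h1 : (Q 0 1 * Q 0 1) * (D 0 1 * D 0 1) ≤ (Q 0 0 * Q 1 1) * (D 0 0 * D 1 1) :=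
      mul_le_mul (by linarith) (by linarith) (mul_self_nonneg _) (by positivity)
    nlinarith [sq_nonneg (Q 0 0 * D 1 1 - Q 1 1 * D 0 0)]
  have := (abs_le.mp key).2
  simp only [det_fin_two, Matrix.add_apply, qs, ds]
  nlinarith

theorem posSemidef_of_isSymm_of_quadratic_nonneg {M : Matrix (Fin 2) (Fin 2) ℝ} (hM : M.IsSymm)
    (h : ∀ w : Fin 2 → ℝ, 0 ≤ w ⬝ᵥ M *ᵥ w) : M.PosSemidef :=
  .of_dotProduct_mulVec_nonneg (by rwa [IsHermitian, conjTranspose_eq_transpose_of_trivial])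
    fun w => by simpa using h w

theorem posSemidef_smul_one_sub_gram {M : Matrix (Fin 2) (Fin 2) ℝ} {K : ℝ} (hK : frobSq M ≤ K) :
    (K • (1 : Matrix (Fin 2) (Fin 2) ℝ) - Mᵀ * M).PosSemidef := by
  refine posSemidef_of_isSymm_of_quadratic_nonneg (by simp [IsSymm]) fun w => ?_
  have h := (vecSq_mulVec_le M w).trans (mul_le_mul_of_nonneg_right hK (vecSq_nonneg w))
  rw [sub_mulVec, dotProduct_sub, ← mulVec_mulVec, dotProduct_mulVec w Mᵀ, vecMul_transpose,
    smul_mulVec, one_mulVec]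
  simp only [vecSq, dotProduct, Fin.sum_univ_two, Pi.smul_apply, smul_eq_mul] at h ⊢
  nlinarith

theorem posSemidef_gram_sub_smul_one {M : Matrix (Fin 2) (Fin 2) ℝ} (hdet : M.det = 1) {K : ℝ}
    (hK0 : 0 < K) (hK : frobSq M ≤ K) :
    (Mᵀ * M - K⁻¹ • (1 : Matrix (Fin 2) (Fin 2) ℝ)).PosSemidef := by
  refine posSemidef_of_isSymm_of_quadratic_nonneg (by simp [IsSymm]) fun w => ?_
  have h := (vecSq_le_mulVec hdet w).trans (mul_le_mul_of_nonneg_right hK (vecSq_nonneg _))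
  rw [← inv_mul_le_iff₀ hK0] at h
  rw [sub_mulVec, dotProduct_sub, ← mulVec_mulVec, dotProduct_mulVec w Mᵀ, vecMul_transpose,
    smul_mulVec, one_mulVec]
  simp only [vecSq, dotProduct, Fin.sum_univ_two, Pi.smul_apply, smul_eq_mul] at h ⊢
  nlinarith

theorem gramSum_posSemidef (A : ℕ → Matrix (Fin 2) (Fin 2) ℝ) (k : ℕ) :
    (gramSum A k).PosSemidef :=
  posSemidef_sum _ fun i _ => by
    simpa [conjTranspose_eq_transpose_of_trivial] using posSemidef_conjTranspose_mul_self (A i)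

theorem trace_gramSum (A : ℕ → Matrix (Fin 2) (Fin 2) ℝ) (k : ℕ) :
    (gramSum A k).trace = ∑ i ∈ Finset.range k, frobSq (A i) := by
  rw [gramSum, trace_sum]
  refine Finset.sum_congr rfl fun i _ => ?_
  simp only [trace_fin_two, mul_apply, Fin.sum_univ_two, transpose_apply, frobSq]
  ring

theorem trace_gramSum_bounds {A T L : ℕ → Matrix (Fin 2) (Fin 2) ℝ}
    {F : Matrix (Fin 2) (Fin 2) ℝ} {K : ℝ} (hK0 : 0 < K)
    (hA : ∀ i, A i = L i * T i * F⁻¹) (hLdet : ∀ i, (L i).det = 1) (hFdet : F.det = 1)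
    (hL : ∀ i, frobSq (L i) ≤ K) (hF : frobSq F ≤ K) (k : ℕ) :
    (K ^ 2)⁻¹ * (gramSum T k).trace ≤ (gramSum A k).trace ∧
      (gramSum A k).trace ≤ K ^ 2 * (gramSum T k).trace := by
  have conj_le : ∀ X Y Z : Matrix (Fin 2) (Fin 2) ℝ, frobSq X ≤ K → frobSq Z ≤ K →
      frobSq (X * Y * Z) ≤ K ^ 2 * frobSq Y := fun X Y Z hX hZ =>
    calc frobSq (X * Y * Z) ≤ frobSq X * frobSq Y * frobSq Z :=
          (frobSq_mul_le _ _).trans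
            (mul_le_mul_of_nonneg_right (frobSq_mul_le _ _) (frobSq_nonneg _))
      _ ≤ K * frobSq Y * K := by
          have := frobSq_nonneg Y
          have := frobSq_nonneg Z
          gcongr
      _ = K ^ 2 * frobSq Y := by ring
  rw [trace_gramSum, trace_gramSum, inv_mul_le_iff₀ (by positivity), Finset.mul_sum,
    Finset.mul_sum]
  refine ⟨Finset.sum_le_sum fun i _ => ?_, Finset.sum_le_sum fun i _ => ?_⟩
  · have hT : T i = (L i)⁻¹ * A i * F := by
      rw [hA, mul_assoc, mul_assoc, nonsing_inv_mul _ (by simp [hFdet]), mul_one, ← mul_assoc,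
        nonsing_inv_mul _ (by simp [hLdet]), one_mul]
    rw [hT]
    exact conj_le _ _ _ (by rw [frobSq_inv (hLdet i)]; exact hL i) hF
  · rw [hA]
    exact conj_le _ _ _ (hL i) (by rwa [frobSq_inv hFdet])

theorem det_gramSum_mul (A : ℕ → Matrix (Fin 2) (Fin 2) ℝ) {F : Matrix (Fin 2) (Fin 2) ℝ}
    (hF : F.det = 1) (k : ℕ) :
    (gramSum (fun i => A i * F) k).det = (gramSum A k).det := by
  have : gramSum (fun i => A i * F) k = Fᵀ * gramSum A k * F := by
    simp only [gramSum, Finset.mul_sum, Finset.sum_mul, transpose_mul, mul_assoc]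
  rw [this, det_mul, det_mul, det_transpose, hF, one_mul, mul_one]

theorem det_gramSum_bounds {A T L : ℕ → Matrix (Fin 2) (Fin 2) ℝ}
    {F : Matrix (Fin 2) (Fin 2) ℝ} {K : ℝ} (hK0 : 0 < K)
    (hA : ∀ i, A i = L i * T i * F⁻¹) (hLdet : ∀ i, (L i).det = 1) (hFdet : F.det = 1)
    (hL : ∀ i, frobSq (L i) ≤ K) (k : ℕ) :
    (K ^ 2)⁻¹ * (gramSum T k).det ≤ (gramSum A k).det ∧
      (gramSum A k).det ≤ K ^ 2 * (gramSum T k).det := by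
  have hdet : (gramSum A k).det = (gramSum (fun i => L i * T i) k).det := by
    rw [funext hA]
    exact det_gramSum_mul _ (by rw [det_nonsing_inv, hFdet, Ring.inverse_one]) k
  have hdet_smul : ∀ (c : ℝ), (c • gramSum T k).det = c ^ 2 * (gramSum T k).det := fun c => by
    rw [det_smul, Fintype.card_fin]
  rw [hdet, ← inv_pow, ← hdet_smul, ← hdet_smul]
  constructor
  · refine det_le_det_of_posSemidef_sub
      ((gramSum_posSemidef T k).smul (by positivity : (0 : ℝ) ≤ K⁻¹)) ?_
    rw [gramSum, gramSum, Finset.smul_sum, ← Finset.sum_sub_distrib]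
    refine posSemidef_sum _ fun i _ => ?_
    have := (posSemidef_gram_sub_smul_one (hLdet i) hK0 (hL i)).conjTranspose_mul_mul_same (T i)
    rw [conjTranspose_eq_transpose_of_trivial] at this
    simpa [mul_sub, sub_mul, mul_assoc] using this
  · refine det_le_det_of_posSemidef_sub (gramSum_posSemidef _ k) ?_
    rw [gramSum, gramSum, Finset.smul_sum, ← Finset.sum_sub_distrib]
    refine posSemidef_sum _ fun i _ => ?_
    have := (posSemidef_smul_one_sub_gram (hL i)).conjTranspose_mul_mul_same (T i)
    rw [conjTranspose_eq_transpose_of_trivial] at this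
    simpa [mul_sub, sub_mul, mul_assoc] using this

/-- The Gram sums of `T` have trace comparable to `k ^ p` and determinant comparable to
`k ^ (p + 1)`, with constant `c`. -/
def GramGrowth (T : ℕ → Matrix (Fin 2) (Fin 2) ℝ) (p : ℕ) (c : ℝ) : Prop :=
  ∀ k : ℕ, 1 ≤ k →
    (c⁻¹ * (k : ℝ) ^ p ≤ (gramSum T k).trace ∧ (gramSum T k).trace ≤ c * (k : ℝ) ^ p) ∧
    (c⁻¹ * (k : ℝ) ^ (p + 1) ≤ (gramSum T k).det ∧ (gramSum T k).det ≤ c * (k : ℝ) ^ (p + 1))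

theorem GramGrowth.conj {A T L : ℕ → Matrix (Fin 2) (Fin 2) ℝ}
    {F : Matrix (Fin 2) (Fin 2) ℝ} {K c : ℝ} {p : ℕ} (hK0 : 0 < K)
    (hA : ∀ i, A i = L i * T i * F⁻¹) (hLdet : ∀ i, (L i).det = 1) (hFdet : F.det = 1)
    (hL : ∀ i, frobSq (L i) ≤ K) (hF : frobSq F ≤ K) (hT : GramGrowth T p c) :
    GramGrowth A p (K ^ 2 * c) := by
  intro k hk
  obtain ⟨⟨t1, t2⟩, d1, d2⟩ := hT k hk
  obtain ⟨a1, a2⟩ := trace_gramSum_bounds hK0 hA hLdet hFdet hL hF k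
  obtain ⟨b1, b2⟩ := det_gramSum_bounds hK0 hA hLdet hFdet hL k
  have hK2 : 0 < K ^ 2 := by positivity
  rw [mul_inv, mul_assoc, mul_assoc, mul_assoc, mul_assoc]
  exact ⟨⟨(mul_le_mul_of_nonneg_left t1 (inv_pos.2 hK2).le).trans a1,
      a2.trans (mul_le_mul_of_nonneg_left t2 hK2.le)⟩,
    (mul_le_mul_of_nonneg_left d1 (inv_pos.2 hK2).le).trans b1,
      b2.trans (mul_le_mul_of_nonneg_left d2 hK2.le)⟩

theorem GramGrowth.inv_spNorm_inv_bounds {A : ℕ → Matrix (Fin 2) (Fin 2) ℝ} {c : ℝ} {p : ℕ}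
    (hc : 0 < c) (hA : GramGrowth A p c) {k : ℕ} (hk : 1 ≤ k) :
    (2 * c ^ 2)⁻¹ * k ≤ (spNorm (gramSum A k)⁻¹)⁻¹ ∧
      (spNorm (gramSum A k)⁻¹)⁻¹ ≤ 2 * c ^ 2 * k := by
  obtain ⟨⟨t1, t2⟩, d1, d2⟩ := hA k hk
  have hk0 : (0 : ℝ) < k := by exact_mod_cast hk
  have ht : 0 < (gramSum A k).trace := lt_of_lt_of_le (by positivity) t1
  have hd : 0 < (gramSum A k).det := lt_of_lt_of_le (by positivity) d1
  obtain ⟨s1, s2⟩ := _root_.inv_spNorm_inv_bounds (gramSum_posSemidef A k) hd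
  constructor
  · refine le_trans ?_ s1
    rw [le_div_iff₀ ht]
    calc (2 * c ^ 2)⁻¹ * k * (gramSum A k).trace ≤ (2 * c ^ 2)⁻¹ * k * (c * (k : ℝ) ^ p) := by
          gcongr
      _ = 2⁻¹ * (c⁻¹ * (k : ℝ) ^ (p + 1)) := by field_simp; ring
      _ ≤ c⁻¹ * (k : ℝ) ^ (p + 1) := by
          have : 0 < c⁻¹ * (k : ℝ) ^ (p + 1) := by positivity
          linarith
      _ ≤ _ := d1
  · refine s2.trans ?_
    rw [mul_assoc]
    refine mul_le_mul_of_nonneg_left ?_ two_pos.le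
    rw [div_le_iff₀ ht]
    calc (gramSum A k).det ≤ c * (k : ℝ) ^ (p + 1) := d2
      _ = c ^ 2 * k * (c⁻¹ * (k : ℝ) ^ p) := by field_simp; ring
      _ ≤ _ := by gcongr

theorem vecSq_smul (c : ℝ) (w : Fin 2 → ℝ) : vecSq (c • w) = c ^ 2 * vecSq w := by
  simp only [vecSq, Pi.smul_apply, smul_eq_mul]; ring

theorem vecSq_conj_bounds {L T F : Matrix (Fin 2) (Fin 2) ℝ} {K : ℝ} (hK0 : 0 < K)
    (hLdet : L.det = 1) (hFdet : F.det = 1) (hL : frobSq L ≤ K) (hF : frobSq F ≤ K)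
    {e w : Fin 2 → ℝ} {c : ℝ} (hTe : vecSq (T *ᵥ e) = vecSq e) (hw : w = c • (F *ᵥ e)) :
    (K ^ 2)⁻¹ * vecSq w ≤ vecSq ((L * T * F⁻¹) *ᵥ w) ∧
      vecSq ((L * T * F⁻¹) *ᵥ w) ≤ K ^ 2 * vecSq w := by
  have hmul : (L * T * F⁻¹) *ᵥ w = c • (L *ᵥ (T *ᵥ e)) := by
    rw [hw, mulVec_smul, mulVec_mulVec, mulVec_mulVec, mul_assoc (L * T),
      nonsing_inv_mul _ (by simp [hFdet]), mul_one]
  have l1 := (vecSq_mulVec_le L (T *ᵥ e)).trans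
    (mul_le_mul_of_nonneg_right hL (vecSq_nonneg _))
  have l2 := (vecSq_le_mulVec hLdet (T *ᵥ e)).trans
    (mul_le_mul_of_nonneg_right hL (vecSq_nonneg _))
  have f1 := (vecSq_mulVec_le F e).trans (mul_le_mul_of_nonneg_right hF (vecSq_nonneg _))
  have f2 := (vecSq_le_mulVec hFdet e).trans (mul_le_mul_of_nonneg_right hF (vecSq_nonneg _))
  rw [hTe] at l1 l2
  rw [hmul, hw, vecSq_smul, vecSq_smul, inv_mul_le_iff₀ (by positivity)]
  have hc : 0 ≤ c ^ 2 := sq_nonneg c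
  constructor
  · calc c ^ 2 * vecSq (F *ᵥ e) ≤ c ^ 2 * (K * (K * vecSq (L *ᵥ (T *ᵥ e)))) := by
          gcongr
          exact f1.trans (mul_le_mul_of_nonneg_left l2 hK0.le)
      _ = _ := by ring
  · calc c ^ 2 * vecSq (L *ᵥ (T *ᵥ e)) ≤ c ^ 2 * (K * (K * vecSq (F *ᵥ e))) := by
          gcongr
          exact l1.trans (mul_le_mul_of_nonneg_left f2 hK0.le)
      _ = _ := by ring

theorem cocIter_eq_conj {d : ℕ} {α : Fin d → ℝ} {S B : (Fin d → ℝ) → Matrix (Fin 2) (Fin 2) ℝ}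
    {R : Matrix (Fin 2) (Fin 2) ℝ} (hBdet : ∀ x, (B x).det = 1)
    (hconj : ∀ x, (B (x + α))⁻¹ * S x * B x = R) (m : ℕ) (x : Fin d → ℝ) :
    cocIter α S m x = B (x + (m : ℝ) • α) * R ^ m * (B x)⁻¹ := by
  have hunit : ∀ x, IsUnit (B x).det := fun x => by simp [hBdet x]
  have hS : ∀ x, S x = B (x + α) * R * (B x)⁻¹ := fun x => by
    rw [← hconj x, mul_assoc, mul_assoc, mul_assoc, mul_nonsing_inv _ (hunit _), mul_one,
      ← mul_assoc, mul_nonsing_inv _ (hunit _), one_mul]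
  induction m with
  | zero => simp [cocIter, mul_nonsing_inv _ (hunit _)]
  | succ m ih =>
    have hx : x + (m : ℝ) • α + α = x + ((m + 1 : ℕ) : ℝ) • α := by
      push_cast
      rw [add_smul, one_smul, add_assoc]
    rw [cocIter, ih, hS, hx, pow_succ']
    simp only [mul_assoc]
    rw [← mul_assoc _ (B (x + (m : ℝ) • α)), nonsing_inv_mul _ (hunit _), one_mul]

theorem IsSolution.cocIter_mulVec {d : ℕ} {v : (Fin d → ℝ) → ℝ} {α θ : Fin d → ℝ} {E : ℝ}
    {u : ℤ → ℝ} (hu : IsSolution v α θ E u) (n : ℤ) (m : ℕ) :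
    cocIter α (schMat v E) m (θ + (n : ℝ) • α) *ᵥ ![u n, u (n - 1)] =
      ![u (n + m), u (n + m - 1)] := by
  induction m with
  | zero => simp [cocIter]
  | succ m ih =>
    have hx : θ + (n : ℝ) • α + (m : ℝ) • α = θ + ((n + m : ℤ) : ℝ) • α := by
      push_cast
      rw [add_smul, add_assoc]
    have h := hu (n + m)
    rw [cocIter, ← mulVec_mulVec, ih, hx, mulVec_fin_two]
    have e1 : n + ((m + 1 : ℕ) : ℤ) = n + m + 1 := by push_cast; ring
    rw [e1, add_sub_cancel_right]
    simp only [schMat, of_apply, cons_val', cons_val_zero, cons_val_one, cons_val_fin_one]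
    congr 1
    · linarith
    · congr 1
      ring

theorem sum_range_two_mul (f : ℕ → ℝ) (k : ℕ) :
    ∑ i ∈ Finset.range (2 * k), f i = ∑ i ∈ Finset.range k, (f (2 * i) + f (2 * i + 1)) := by
  induction k with
  | zero => simp
  | succ k ih => rw [mul_add, mul_one, Finset.sum_range_succ, Finset.sum_range_succ, ih,
      Finset.sum_range_succ]; ring

theorem IsSolution.normSqPlus_eq {d : ℕ} {v : (Fin d → ℝ) → ℝ} {α θ : Fin d → ℝ} {E : ℝ}
    {u : ℤ → ℝ} (hu : IsSolution v α θ E u) (k : ℕ) :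
    normSqPlus u k = ∑ i ∈ Finset.range k,
      vecSq (cocIter α (schMat v E) (2 * i + 1) (θ + α) *ᵥ ![u 1, u 0]) := by
  rw [normSqPlus, sum_range_two_mul]
  refine Finset.sum_congr rfl fun i _ => ?_
  have h := hu.cocIter_mulVec 1 (2 * i + 1)
  rw [Int.cast_one, one_smul, sub_self] at h
  rw [h, vecSq]
  simp only [cons_val_zero, cons_val_one]
  push_cast
  rw [add_comm]
  congr 3 <;> ring

theorem IsSolution.normSqMinus_eq {d : ℕ} {v : (Fin d → ℝ) → ℝ} {α θ : Fin d → ℝ} {E : ℝ}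
    {u : ℤ → ℝ} (hu : IsSolution v α θ E u) (k : ℕ)
    (hdet : ∀ m x, (cocIter α (schMat v E) m x).det = 1) :
    normSqMinus u k = ∑ i ∈ Finset.range k,
      vecSq ((cocIter α (schMat v E) (2 * i + 1) (θ + α - (2 * i + 1 : ℝ) • α))⁻¹ *ᵥ
        ![u 1, u 0]) := by
  rw [normSqMinus, sum_range_two_mul]
  refine Finset.sum_congr rfl fun i _ => ?_
  have h := hu.cocIter_mulVec (-(2 * i)) (2 * i + 1)
  have hx : θ + ((-(2 * i) : ℤ) : ℝ) • α = θ + α - (2 * i + 1 : ℝ) • α := by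
    push_cast
    module
  have e1 : (-(2 * i) : ℤ) + (2 * i + 1 : ℕ) = 1 := by push_cast; ring
  rw [hx, e1, sub_self] at h
  rw [← h, mulVec_mulVec, nonsing_inv_mul _ (by simp [hdet]), one_mulVec, vecSq]
  simp only [cons_val_zero, cons_val_one]
  push_cast
  congr 3
  ring

theorem exists_angle (p q : ℝ) :
    ∃ β ∈ Set.Ioc (-(Real.pi / 2)) (Real.pi / 2), q * Real.cos β + p * Real.sin β = 0 := by
  have hpi := Real.pi_pos
  by_cases hp : p = 0
  · exact ⟨Real.pi / 2, ⟨by linarith, le_rfl⟩, by simp [hp]⟩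
  · refine ⟨Real.arctan (-q / p), ⟨Real.neg_pi_div_two_lt_arctan _,
      (Real.arctan_lt_pi_div_two _).le⟩, ?_⟩
    have hcos := (Real.cos_arctan_pos (-q / p)).ne'
    have ht := Real.tan_arctan (-q / p)
    rw [Real.tan_eq_sin_div_cos, div_eq_iff hcos] at ht
    rw [ht]
    field_simp
    ring

theorem eq_smul_of_orthogonal {z w : Fin 2 → ℝ} {β : ℝ} (hz : vecSq z ≠ 0)
    (h1 : z 1 * Real.cos β + z 0 * Real.sin β = 0) (h2 : w 1 * Real.cos β + w 0 * Real.sin β = 0) :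
    ∃ c : ℝ, w = c • z := by
  have h := Real.sin_sq_add_cos_sq β
  have hdet : w 0 * z 1 = w 1 * z 0 := by
    linear_combination (-(w 0 * z 1) + w 1 * z 0) * h +
      (w 0 * Real.cos β - w 1 * Real.sin β) * h1 + (z 1 * Real.sin β - z 0 * Real.cos β) * h2
  refine ⟨(w 0 * z 0 + w 1 * z 1) / vecSq z, ?_⟩
  ext i
  rw [Pi.smul_apply, smul_eq_mul, div_mul_eq_mul_div, eq_div_iff hz, vecSq]
  fin_cases i
  · simp only [Fin.zero_eta]
    linear_combination z 1 * hdet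
  · simp only [Fin.mk_one]
    linear_combination -z 0 * hdet

theorem reducibleAsymptotics_of_gramGrowth {d : ℕ} {α : Fin d → ℝ} {v : (Fin d → ℝ) → ℝ} {E : ℝ}
    {B : (Fin d → ℝ) → Matrix (Fin 2) (Fin 2) ℝ} (hBdet : ∀ x, (B x).det = 1)
    (hBbdd : BddAbove (Set.range fun x => spNorm (B x))) {R : Matrix (Fin 2) (Fin 2) ℝ}
    (hconj : ∀ x, (B (x + α))⁻¹ * schMat v E x * B x = R) {p : ℕ} {c : ℝ} (hc : 1 ≤ c)
    (hplus : GramGrowth (fun i => R ^ (2 * i + 1)) p c)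
    (hminus : GramGrowth (fun i => (R ^ (2 * i + 1))⁻¹) p c)
    (he : ∀ m, vecSq (R ^ m *ᵥ ![1, 0]) = 1 ∧ vecSq ((R ^ m)⁻¹ *ᵥ ![1, 0]) = 1) :
    ReducibleAsymptotics v α E (p + 1) := by
  obtain ⟨M, hM⟩ := hBbdd
  obtain ⟨K, hK1, hK⟩ : ∃ K : ℝ, 1 ≤ K ∧ ∀ x, frobSq (B x) ≤ K :=
    ⟨2 * M ^ 2 + 1, by nlinarith [sq_nonneg M], fun x => by
      have hx : spNorm (B x) ≤ M := hM ⟨x, rfl⟩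
      nlinarith [frobSq_le_spNorm (B x), spNorm_nonneg (B x)]⟩
  have hK0 : 0 < K := by linarith
  have hc0 : 0 < c := by linarith
  have hunit : ∀ x, IsUnit (B x).det := fun x => by simp [hBdet x]
  have hcoc := cocIter_eq_conj (S := schMat v E) hBdet hconj
  have hcocdet : ∀ m x, (cocIter α (schMat v E) m x).det = 1 := fun m x => by
    induction m with
    | zero => simp [cocIter]
    | succ m ih => rw [cocIter, det_mul, ih, schMat, det_fin_two_of]; ring
  set D : ℝ := K ^ 2 * c with hD
  have hD0 : 0 < D := by positivity
  have hKD : K ^ 2 ≤ D := le_mul_of_one_le_right (by positivity) hc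
  have hD1 : 1 ≤ D := by nlinarith
  have hDD : D ≤ 2 * D ^ 2 := by nlinarith
  refine ⟨2 * D ^ 2, by positivity, fun θ => ⟨1, fun k hk => ?_⟩⟩
  have hk0 : (0 : ℝ) < k := by exact_mod_cast hk
  have hAp : ∀ i : ℕ, cocIter α (schMat v E) (2 * i + 1) (θ + α) =
      B (θ + α + ((2 * i + 1 : ℕ) : ℝ) • α) * R ^ (2 * i + 1) * (B (θ + α))⁻¹ :=
    fun i => hcoc _ _
  have hAm : ∀ i : ℕ, (cocIter α (schMat v E) (2 * i + 1) (θ + α - (2 * i + 1 : ℝ) • α))⁻¹ =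
      B (θ + α - (2 * i + 1 : ℝ) • α) * (R ^ (2 * i + 1))⁻¹ * (B (θ + α))⁻¹ := fun i => by
    rw [hcoc, Matrix.mul_inv_rev, Matrix.mul_inv_rev, nonsing_inv_nonsing_inv _ (hunit _),
      mul_assoc]
    push_cast
    rw [sub_add_cancel]
  have gp := hplus.conj hK0 hAp (fun _ => hBdet _) (hBdet _) (fun _ => hK _) (hK _)
  have gm := hminus.conj hK0 hAm (fun _ => hBdet _) (hBdet _) (fun _ => hK _) (hK _)
  rw [← hD] at gp gm
  have widen : ∀ {x y : ℝ}, 0 ≤ y → D⁻¹ * y ≤ x ∧ x ≤ D * y →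
      (2 * D ^ 2)⁻¹ * y ≤ x ∧ x ≤ 2 * D ^ 2 * y := fun hy h =>
    ⟨(mul_le_mul_of_nonneg_right (inv_anti₀ hD0 hDD) hy).trans h.1,
      h.2.trans (mul_le_mul_of_nonneg_right hDD hy)⟩
  refine ⟨gp.inv_spNorm_inv_bounds hD0 hk, gm.inv_spNorm_inv_bounds hD0 hk,
    widen (by positivity) (gp k hk).2, widen (by positivity) (gm k hk).2, ?_⟩
  set z : Fin 2 → ℝ := B (θ + α) *ᵥ ![1, 0] with hz
  have he1 : vecSq ![1, 0] = 1 := by simp [vecSq]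
  have hz0 : vecSq z ≠ 0 := fun h => by
    have := vecSq_le_mulVec (hBdet (θ + α)) ![1, 0]
    rw [← hz, h, he1] at this
    linarith
  obtain ⟨β, hβ, hβz⟩ := exists_angle (z 0) (z 1)
  refine ⟨β, hβ, fun u hu hbc hnorm => ?_⟩
  obtain ⟨a, ha⟩ := eq_smul_of_orthogonal (w := ![u 1, u 0]) hz0 hβz (by simpa using hbc)
  have hw : vecSq ![u 1, u 0] = 1 := by simp only [vecSq, cons_val_zero, cons_val_one]; linarith
  have sum_bounds : ∀ f : ℕ → ℝ, (∀ i, (K ^ 2)⁻¹ ≤ f i ∧ f i ≤ K ^ 2) →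
      (2 * D ^ 2)⁻¹ * k ≤ ∑ i ∈ Finset.range k, f i ∧
        ∑ i ∈ Finset.range k, f i ≤ 2 * D ^ 2 * k := fun f hf => by
    refine widen hk0.le ⟨?_, ?_⟩
    · have h := Finset.card_nsmul_le_sum (Finset.range k) f _ fun i _ => (hf i).1
      rw [Finset.card_range, nsmul_eq_mul, mul_comm] at h
      exact (mul_le_mul_of_nonneg_right (inv_anti₀ (by positivity) hKD) hk0.le).trans h
    · have h := Finset.sum_le_card_nsmul (Finset.range k) f _ fun i _ => (hf i).2
      rw [Finset.card_range, nsmul_eq_mul, mul_comm] at h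
      exact h.trans (mul_le_mul_of_nonneg_right hKD hk0.le)
  rw [hu.normSqPlus_eq, hu.normSqMinus_eq k hcocdet]
  refine ⟨sum_bounds _ fun i => ?_, sum_bounds _ fun i => ?_⟩
  · have := vecSq_conj_bounds hK0 (hBdet (θ + α + ((2 * i + 1 : ℕ) : ℝ) • α)) (hBdet (θ + α))
      (hK _) (hK _) ((he (2 * i + 1)).1.trans he1.symm) ha
    rwa [← hAp, hw, mul_one, mul_one] at this
  · have := vecSq_conj_bounds hK0 (hBdet (θ + α - (2 * i + 1 : ℝ) • α)) (hBdet (θ + α))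
      (hK _) (hK _) ((he (2 * i + 1)).2.trans he1.symm) ha
    rwa [← hAm, hw, mul_one, mul_one] at this

theorem gramGrowth_of_orthogonal {T : ℕ → Matrix (Fin 2) (Fin 2) ℝ} (hT : ∀ i, (T i)ᵀ * T i = 1) :
    GramGrowth T 1 2 := by
  intro k hk
  have hk0 : (0 : ℝ) < k := by exact_mod_cast hk
  have hsum : gramSum T k = (k : ℝ) • (1 : Matrix (Fin 2) (Fin 2) ℝ) := by
    simp [gramSum, hT, Nat.cast_smul_eq_nsmul]
  rw [hsum, trace_smul, trace_one, det_smul, det_one, Fintype.card_fin]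
  simp only [smul_eq_mul, Nat.cast_ofNat, pow_one, mul_one, one_add_one_eq_two]
  have := sq_nonneg (k : ℝ)
  refine ⟨⟨?_, ?_⟩, ?_, ?_⟩ <;> linarith

theorem gramSum_shear (ν : ℝ) (k : ℕ) :
    gramSum (fun i => !![1, (2 * i + 1 : ℝ) * ν; 0, 1]) k =
      !![(k : ℝ), k ^ 2 * ν; k ^ 2 * ν, k + ν ^ 2 / 3 * (4 * k ^ 3 - k)] := by
  induction k with
  | zero => ext i j; fin_cases i <;> fin_cases j <;> simp [gramSum]
  | succ k ih =>
    rw [gramSum, Finset.sum_range_succ, ← gramSum, ih]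
    ext i j
    fin_cases i <;> fin_cases j <;> simp [mul_apply, Fin.sum_univ_two] <;> ring

theorem gramGrowth_shear {ν c : ℝ} (hc : 1 ≤ c) (hνc : ν ^ 2 / 3 ≤ c) (hcν : c⁻¹ ≤ ν ^ 2 / 3) :
    GramGrowth (fun i => !![1, (2 * i + 1 : ℝ) * ν; 0, 1]) 3 (5 * c) := by
  intro k hk
  have hk1 : (1 : ℝ) ≤ k := by exact_mod_cast hk
  rw [gramSum_shear, trace_fin_two_of, det_fin_two_of]
  have hinv : c⁻¹ ≤ 1 := inv_le_one_of_one_le₀ hc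
  have hinv0 : 0 < c⁻¹ := by positivity
  set x : ℝ := (k : ℝ)
  set m := ν ^ 2 / 3 with hm
  have h3 : x ≤ x ^ 3 := le_self_pow₀ hk1 (by norm_num)
  have h4 : x ^ 2 ≤ x ^ 4 := pow_le_pow_right₀ hk1 (by norm_num)
  have hdet : x * (x + m * (4 * x ^ 3 - x)) - x ^ 2 * ν * (x ^ 2 * ν) =
      x ^ 2 + m * (x ^ 4 - x ^ 2) := by rw [hm]; ring
  have hx0 : 0 < x := by linarith
  have hx4 : 0 ≤ x ^ 4 - x ^ 2 := by linarith
  have hx3 : 0 ≤ 4 * x ^ 3 - x := by linarith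
  rw [hdet, mul_inv, mul_assoc, mul_assoc]
  have l1 := mul_le_mul_of_nonneg_right hcν hx3
  have l2 := mul_le_mul_of_nonneg_right hνc hx3
  have l3 := mul_le_mul_of_nonneg_right hcν hx4
  have l4 := mul_le_mul_of_nonneg_right hνc hx4
  have i1 := mul_le_mul_of_nonneg_right hinv hx0.le
  have i2 := mul_le_mul_of_nonneg_right hc hx0.le
  have i3 := mul_le_mul_of_nonneg_right hinv (sq_nonneg x)
  have i4 := mul_le_mul_of_nonneg_right hc (sq_nonneg x)
  have p3 : 0 ≤ c⁻¹ * x ^ 3 := by positivity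
  have p4 : 0 ≤ c⁻¹ * x ^ 4 := by positivity
  have q4 : 0 ≤ c * x ^ 4 := by positivity
  have q3 : c * x ≤ c * x ^ 3 := mul_le_mul_of_nonneg_left h3 (by linarith)
  have p1 : 0 ≤ c⁻¹ * x := by positivity
  norm_num
  refine ⟨⟨?_, ?_⟩, ?_, ?_⟩ <;> linarith

theorem shear_pow (ν : ℝ) (m : ℕ) :
    (!![1, ν; 0, 1] : Matrix (Fin 2) (Fin 2) ℝ) ^ m = !![1, (m : ℝ) * ν; 0, 1] := by
  induction m with
  | zero => simp [one_fin_two]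
  | succ m ih =>
    rw [pow_succ, ih]
    ext i j
    fin_cases i <;> fin_cases j <;> simp [mul_apply, Fin.sum_univ_two]
    ring

theorem shear_pow_inv (ν : ℝ) (m : ℕ) :
    ((!![1, ν; 0, 1] : Matrix (Fin 2) (Fin 2) ℝ) ^ m)⁻¹ = !![1, (m : ℝ) * -ν; 0, 1] := by
  rw [shear_pow, inv_of_det_eq_one (by simp [det_fin_two])]
  simp

theorem vecSq_mulVec_of_orthogonal {M : Matrix (Fin 2) (Fin 2) ℝ} (hM : Mᵀ * M = 1)
    (w : Fin 2 → ℝ) : vecSq (M *ᵥ w) = vecSq w := by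
  have hv : ∀ x : Fin 2 → ℝ, vecSq x = x ⬝ᵥ x := fun x => by
    simp only [vecSq, dotProduct, Fin.sum_univ_two]; ring
  rw [hv, hv, dotProduct_mulVec, vecMul_mulVec, hM, vecMul_one]

/-- asymptotics of `P_{(k),±}` for reducible Schrödinger cocycles
(Proposition on reducible energies). -/
theorem reducible_asymptotics
    (d : ℕ) (α : Fin d → ℝ)
    (v : (Fin d → ℝ) → ℝ)
    (hvper : ∀ (x : Fin d → ℝ) (m : Fin d → ℤ), v (x + fun i => (m i : ℝ)) = v x)
    (hvcont : Continuous v) (E : ℝ)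
    (B : (Fin d → ℝ) → Matrix (Fin 2) (Fin 2) ℝ)
    (hBdet : ∀ x, (B x).det = 1)
    (hBbdd : BddAbove (Set.range fun x => spNorm (B x)))
    (R : Matrix (Fin 2) (Fin 2) ℝ)
    (hconj : ∀ x, (B (x + α))⁻¹ * schMat v E x * B x = R) :
    -- (1) rotation case: `det P_{(k),±} ≍ k²`
    ((∃ ρ : ℝ, R = !![Real.cos (2 * Real.pi * ρ), -Real.sin (2 * Real.pi * ρ);
        Real.sin (2 * Real.pi * ρ), Real.cos (2 * Real.pi * ρ)]) →
      ReducibleAsymptotics v α E 2) ∧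
    -- (2) parabolic case: `det P_{(k),±} ≍ k⁴`
    ((∃ ν : ℝ, ν ≠ 0 ∧ R = !![1, ν; 0, 1]) →
      ReducibleAsymptotics v α E 4) := by
  constructor
  · rintro ⟨ρ, hR⟩
    have hRR : Rᵀ * R = 1 := by
      have h := Real.sin_sq_add_cos_sq (2 * Real.pi * ρ)
      rw [hR]
      ext i j
      fin_cases i <;> fin_cases j <;> simp [mul_apply, Fin.sum_univ_two] <;> linarith
    have hpow : ∀ m, (R ^ m)ᵀ * R ^ m = 1 := fun m => by
      have := pow_mem (S := orthogonalGroup (Fin 2) ℝ)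
        ((mem_orthogonalGroup_iff' (Fin 2) ℝ).2 hRR) m
      exact (mem_orthogonalGroup_iff' (Fin 2) ℝ).1 this
    have hinv : ∀ m, ((R ^ m)⁻¹)ᵀ * (R ^ m)⁻¹ = 1 := fun m => by
      rw [inv_eq_left_inv (hpow m), transpose_transpose, mul_eq_one_comm]
      exact hpow m
    have he : vecSq ![1, 0] = 1 := by simp [vecSq]
    exact reducibleAsymptotics_of_gramGrowth hBdet hBbdd hconj (p := 1) one_le_two
      (gramGrowth_of_orthogonal fun _ => hpow _) (gramGrowth_of_orthogonal fun _ => hinv _)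
      fun m => ⟨(vecSq_mulVec_of_orthogonal (hpow m) _).trans he,
        (vecSq_mulVec_of_orthogonal (hinv m) _).trans he⟩
  · rintro ⟨ν, hν, hR⟩
    have hm : 0 < ν ^ 2 / 3 := by positivity
    set c : ℝ := 1 + ν ^ 2 / 3 + (ν ^ 2 / 3)⁻¹ with hc
    have hm' : 0 < (ν ^ 2 / 3)⁻¹ := inv_pos.2 hm
    have hc1 : 1 ≤ c := by linarith
    have hνc : ν ^ 2 / 3 ≤ c := by linarith
    have hcν : c⁻¹ ≤ ν ^ 2 / 3 := inv_le_of_inv_le₀ hm (by linarith)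
    refine reducibleAsymptotics_of_gramGrowth hBdet hBbdd hconj (p := 3) (c := 5 * c)
      (by linarith) ?_ ?_ fun m => ?_
    · have := gramGrowth_shear hc1 hνc hcν
      simpa [hR, shear_pow] using this
    · have := gramGrowth_shear (ν := -ν) hc1 (by rwa [neg_sq]) (by rwa [neg_sq])
      simpa [hR, shear_pow_inv] using this
    · rw [hR, shear_pow_inv, shear_pow]
      constructor <;> simp [vecSq]
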